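/- Let X be an n-correct set and let f be a polynomial of degree k with 1 ≤ k ≤ n whose zero set is a curve with no multiple components (f is squarefree). Then f is a maximal curve for X if and only if every node of X not lying on f uses f, i.e., f divides p*_A for every A ∈ X with f(A) ≠ 0. -/

import Mathlib

open MvPolynomial Finset
open scoped Classical BigOperators

noncomputable section

/-- Points of the plane. -/
abbrev Pt : Type := Fin 2 → ℝ

/-- Bivariate real polynomials. -/
abbrev Poly2 : Type := MvPolynomial (Fin 2) ℝ

/-- `N = dim Π_n = (n+1)(n+2)/2`. -/
def Nn (n : ℕ) : ℕ := (n + 1) * (n + 2) / 2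

/-- `X` is an `n`-correct set of nodes: it has `N` nodes and the only polynomial of total
degree at most `n` vanishing at all of them is the zero polynomial. -/
def IsNCorrect (n : ℕ) (X : Finset Pt) : Prop :=
  X.card = Nn n ∧
  ∀ p : Poly2, p.totalDegree ≤ n → (∀ P ∈ X, eval P p = 0) → p = 0

/-- A line: a (nonzero) polynomial of total degree exactly 1. -/
def IsLine (ℓ : Poly2) : Prop := ℓ.totalDegree = 1

/-- The zero set of a polynomial, as a subset of the plane. -/
def zeroSet (q : Poly2) : Set Pt := {P : Pt | eval P q = 0}

/-- `X ∩ q` : the nodes of `X` lying on the curve `q`. -/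
def zerosIn (X : Finset Pt) (q : Poly2) : Finset Pt := X.filter fun P => eval P q = 0

/-- `X \ q` : the nodes of `X` not lying on the curve `q`. -/
def nonzerosIn (X : Finset Pt) (q : Poly2) : Finset Pt := X.filter fun P => eval P q ≠ 0

/-- `ℓ` is a maximal line for (an `n`-correct set) `X`: a line passing through
exactly `n+1` nodes. -/
def IsMaximalLine (n : ℕ) (X : Finset Pt) (ℓ : Poly2) : Prop :=
  IsLine ℓ ∧ (zerosIn X ℓ).card = n + 1

/-- The collection of maximal lines of `X` (as subsets of the plane). -/
def maximalLines (n : ℕ) (X : Finset Pt) : Set (Set Pt) :=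
  {Z : Set Pt | ∃ ℓ : Poly2, IsMaximalLine n X ℓ ∧ Z = zeroSet ℓ}

/-- `p` is the `n`-fundamental polynomial of the node `A` of `X`. -/
def IsFund (n : ℕ) (X : Finset Pt) (A : Pt) (p : Poly2) : Prop :=
  p.totalDegree ≤ n ∧ eval A p = 1 ∧ ∀ P ∈ X, P ≠ A → eval P p = 0

/-- The node `A` of `X` uses the curve `q`: `q` divides the fundamental polynomial of `A`. -/
def Uses (n : ℕ) (X : Finset Pt) (A : Pt) (q : Poly2) : Prop :=
  ∃ p : Poly2, IsFund n X A p ∧ q ∣ p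

/-- `d(n,k) = k(2n+3-k)/2`. -/
def d (n k : ℕ) : ℕ := k * (2 * n + 3 - k) / 2

/-- `q` is a maximal curve of degree `k` for `X`: it passes through exactly `d(n,k)` nodes. -/
def IsMaximalCurve (n k : ℕ) (X : Finset Pt) (q : Poly2) : Prop :=
  q.totalDegree = k ∧ (zerosIn X q).card = d n k

/-- `{A,B,C}` is a special triplet of the `n`-correct set `X` : there is a maximal curve `f`
of degree `n-1` with `X \ f = {A,B,C}`. -/
def IsSpecialTriplet (n : ℕ) (X : Finset Pt) (A B C : Pt) : Prop :=
  A ∈ X ∧ B ∈ X ∧ C ∈ X ∧ A ≠ B ∧ A ≠ C ∧ B ≠ C ∧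
  ∃ f : Poly2, IsMaximalCurve n (n - 1) X f ∧ nonzerosIn X f = {A, B, C}

/-- `X` is a `GC_n` set: an `n`-correct set in which every fundamental polynomial is a
product of `n` linear factors. -/
def IsGC (n : ℕ) (X : Finset Pt) : Prop :=
  IsNCorrect n X ∧
  ∀ A ∈ X, ∃ p : Poly2, IsFund n X A p ∧
    ∃ g : Fin n → Poly2, (∀ i, (g i).totalDegree = 1) ∧ p = ∏ i, g i

/-- `ℓ` is a line passing through the points `P` and `Q` (in particular, `ℓ_{PQ}` when
`P ≠ Q`). -/
def IsLineThrough (ℓ : Poly2) (P Q : Pt) : Prop :=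
  IsLine ℓ ∧ eval P ℓ = 0 ∧ eval Q ℓ = 0

/-- `ℓ` is a `2`-node line of `X` passing through exactly the two nodes `A` and `B`. -/
def IsTwoNodeLineOf (X : Finset Pt) (ℓ : Poly2) (A B : Pt) : Prop :=
  IsLine ℓ ∧ A ≠ B ∧ zerosIn X ℓ = {A, B}

/-- `Y` is an `n`-independent set: every point has an `n`-fundamental polynomial. -/
def IsNIndependent (n : ℕ) (Y : Finset Pt) : Prop :=
  ∀ A ∈ Y, ∃ p : Poly2, p.totalDegree ≤ n ∧ eval A p ≠ 0 ∧
    ∀ P ∈ Y, P ≠ A → eval P p = 0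

/-- A family of lines is in general position: no two parallel (or equal) — i.e. any two of
them meet in a unique point — and no three concurrent. -/
def GenPos {m : ℕ} (ℓ : Fin m → Poly2) : Prop :=
  (∀ i, IsLine (ℓ i)) ∧
  (∀ i j, i ≠ j → ∃! P : Pt, eval P (ℓ i) = 0 ∧ eval P (ℓ j) = 0) ∧
  (∀ i j k, i ≠ j → i ≠ k → j ≠ k →
    ¬∃ P : Pt, eval P (ℓ i) = 0 ∧ eval P (ℓ j) = 0 ∧ eval P (ℓ k) = 0)

/-- `X` is a Chung–Yao set of degree `n`: the set of pairwise intersection points of `n+2`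
lines in general position. -/
def IsChungYao (n : ℕ) (X : Finset Pt) : Prop :=
  ∃ ℓ : Fin (n + 2) → Poly2, GenPos ℓ ∧
    (↑X : Set Pt) = {P : Pt | ∃ i j, i ≠ j ∧ eval P (ℓ i) = 0 ∧ eval P (ℓ j) = 0}

/-- `X` is a Carnicer–Gasca set of degree `n`: the pairwise intersection points of `n+1`
lines in general position together with one extra point `A i` on each line `ℓ i`, the `A i`
lying on no other line of the family and not all collinear. -/
def IsCarnicerGasca (n : ℕ) (X : Finset Pt) : Prop :=
  ∃ (ℓ : Fin (n + 1) → Poly2) (A : Fin (n + 1) → Pt), GenPos ℓ ∧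
    (∀ i j, eval (A i) (ℓ j) = 0 ↔ j = i) ∧
    (¬∃ L : Poly2, IsLine L ∧ ∀ i, eval (A i) L = 0) ∧
    (↑X : Set Pt) =
      {P : Pt | ∃ i j, i ≠ j ∧ eval P (ℓ i) = 0 ∧ eval P (ℓ j) = 0} ∪ Set.range A

lemma two_mul_Nn (m : ℕ) : 2 * Nn m = (m + 1) * (m + 2) :=
  Nat.mul_div_cancel' (Nat.even_mul_succ_self (m + 1)).two_dvd

lemma Nn_succ (m : ℕ) : Nn (m + 1) = Nn m + (m + 2) := by
  have h₁ := two_mul_Nn m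
  have h₂ := two_mul_Nn (m + 1)
  linarith

lemma d_add_Nn_sub {n k : ℕ} (hkn : k ≤ n) : d n k + Nn (n - k) = Nn n := by
  obtain ⟨m, rfl⟩ := Nat.exists_eq_add_of_le hkn
  have h₁ := two_mul_Nn m
  have h₂ := two_mul_Nn (k + m)
  have hk : 2 * (k + m) + 3 - k = k + 2 * m + 3 := by omega
  have h : k * (k + 2 * m + 3) + 2 * Nn m = 2 * Nn (k + m) := by
    rw [h₁, h₂]
    ring
  rw [d, hk, Nat.add_sub_cancel_left]
  omega

lemma card_biUnion_antidiagonal (m : ℕ) :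
    ((range (m + 1)).biUnion fun i => antidiagonal i).card = Nn m := by
  rw [card_biUnion]
  · induction m with
    | zero => simp [Nn]
    | succ m ih => rw [sum_range_succ, ih, Nn_succ, Nat.card_antidiagonal]
  · intro i _ j _ hij
    refine disjoint_left.2 fun x hi hj => hij ?_
    rw [HasAntidiagonal.mem_antidiagonal] at hi hj
    omega

/-- `dim Π_m = (m+1)(m+2)/2`. -/
lemma finrank_restrictTotalDegree (m : ℕ) :
    Module.finrank ℝ (restrictTotalDegree (Fin 2) ℝ m) = Nn m := by
  refine (Module.finrank_eq_nat_card_basis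
    (basisRestrictSupport ℝ {s : Fin 2 →₀ ℕ | (s.sum fun _ e => e) ≤ m})).trans ?_
  rw [← card_biUnion_antidiagonal m,
    ← Nat.subtype_card (p := fun x : ℕ × ℕ => x.1 + x.2 ≤ m) _ fun x => by simp]
  refine Nat.card_congr ((finTwoArrowEquiv' ℕ).subtypeEquiv fun s => ?_)
  rw [← finTwoArrowEquiv'_sum_eq, Equiv.symm_apply_apply]
  rfl

/-- Evaluation of the polynomials of degree at most `m` at the nodes of `Y`. -/
def evalOn (m : ℕ) (Y : Finset Pt) : restrictTotalDegree (Fin 2) ℝ m →ₗ[ℝ] (Y → ℝ) :=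
  LinearMap.pi fun P => (aeval (P : Pt)).toLinearMap ∘ₗ Submodule.subtype _

lemma evalOn_apply {m : ℕ} {Y : Finset Pt} (p : restrictTotalDegree (Fin 2) ℝ m) (P : Y) :
    evalOn m Y p P = eval (P : Pt) (p : Poly2) := by
  simp [evalOn]

lemma evalOn_injective {m : ℕ} {Y : Finset Pt}
    (h : ∀ p : Poly2, p.totalDegree ≤ m → (∀ P ∈ Y, eval P p = 0) → p = 0) :
    Function.Injective (evalOn m Y) := by
  refine (injective_iff_map_eq_zero _).2 fun p hp => Subtype.ext ?_
  refine h p ((mem_restrictTotalDegree _ _ _).1 p.2) fun P hP => ?_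
  rw [← evalOn_apply p ⟨P, hP⟩, hp, Pi.zero_apply]

lemma Nn_le_card {m : ℕ} {Y : Finset Pt}
    (h : ∀ p : Poly2, p.totalDegree ≤ m → (∀ P ∈ Y, eval P p = 0) → p = 0) :
    Nn m ≤ Y.card := by
  simpa [finrank_restrictTotalDegree] using
    LinearMap.finrank_le_finrank_of_injective (evalOn_injective h)

lemma IsNCorrect.exists_isFund {m : ℕ} {Y : Finset Pt} (hY : IsNCorrect m Y) {A : Pt}
    (hA : A ∈ Y) : ∃ p, IsFund m Y A p := by
  have hsurj : Function.Surjective (evalOn m Y) :=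
    (LinearMap.injective_iff_surjective_of_finrank_eq_finrank
      (by simp [finrank_restrictTotalDegree, hY.1])).1 (evalOn_injective hY.2)
  obtain ⟨p, hp⟩ := hsurj (Pi.single ⟨A, hA⟩ 1)
  refine ⟨p, (mem_restrictTotalDegree _ _ _).1 p.2, ?_, fun P hP hne => ?_⟩
  · rw [← evalOn_apply p ⟨A, hA⟩, hp, Pi.single_eq_same]
  · rw [← evalOn_apply p ⟨P, hP⟩, hp, Pi.single_eq_of_ne (by simpa using hne)]

lemma IsNCorrect.isFund_unique {n : ℕ} {X : Finset Pt} (hX : IsNCorrect n X) {A : Pt}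
    {p q : Poly2} (hp : IsFund n X A p) (hq : IsFund n X A q) : p = q := by
  refine sub_eq_zero.1 (hX.2 _ ((totalDegree_sub p q).trans (max_le hp.1 hq.1)) fun P hP => ?_)
  by_cases h : P = A
  · rw [h, map_sub, hp.2.1, hq.2.1, sub_self]
  · rw [map_sub, hp.2.2 P hP h, hq.2.2 P hP h, sub_self]

lemma card_le_Nn {m : ℕ} {Y : Finset Pt} (h : IsNIndependent m Y) : Y.card ≤ Nn m := by
  choose p hdeg hne hzero using h
  let q (A : Y) : restrictTotalDegree (Fin 2) ℝ m :=
    ⟨p A A.2, (mem_restrictTotalDegree _ _ _).2 (hdeg A A.2)⟩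
  have hq : LinearIndependent ℝ q := by
    refine Fintype.linearIndependent_iff.2 fun c hc A => ?_
    have hA := congrFun (congrArg (evalOn m Y) hc) A
    simp only [map_sum, map_smul, map_zero, Finset.sum_apply, Pi.smul_apply, Pi.zero_apply,
      smul_eq_mul] at hA
    simp only [evalOn_apply, q] at hA
    rw [Fintype.sum_eq_single A fun B hB => by
      rw [hzero B B.2 A A.2 fun h => hB (Subtype.ext h.symm), mul_zero]] at hA
    exact (mul_eq_zero.1 hA).resolve_right (hne A A.2)
  simpa [finrank_restrictTotalDegree] using hq.fintype_card_le_finrank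

/-- A polynomial of complementary degree vanishing at the nodes off a curve is zero. -/
lemma IsNCorrect.eq_zero_of_nonzerosIn {n : ℕ} {X : Finset Pt} (hX : IsNCorrect n X)
    {f : Poly2} (hf : f ≠ 0) (hfn : f.totalDegree ≤ n) (g : Poly2)
    (hg : g.totalDegree ≤ n - f.totalDegree) (hgX : ∀ P ∈ nonzerosIn X f, eval P g = 0) :
    g = 0 := by
  refine (mul_eq_zero.1 (hX.2 (f * g) ((totalDegree_mul f g).trans (by omega))
    fun P hP => ?_)).resolve_left hf
  rw [map_mul, mul_eq_zero, or_iff_not_imp_left]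
  exact fun h => hgX P (mem_filter.2 ⟨hP, h⟩)

lemma IsNCorrect.isMaximalCurve_iff {n : ℕ} {X : Finset Pt} (hX : IsNCorrect n X) {f : Poly2}
    (hfn : f.totalDegree ≤ n) :
    IsMaximalCurve n f.totalDegree X f ↔ (nonzerosIn X f).card = Nn (n - f.totalDegree) := by
  have hcard : (zerosIn X f).card + (nonzerosIn X f).card = X.card :=
    card_filter_add_card_filter_not fun P => eval P f = 0
  have hd := d_add_Nn_sub hfn
  rw [hX.1] at hcard
  simp only [IsMaximalCurve, true_and]
  omega

/-- Multiplying by `f` turns a fundamental polynomial for the nodes off the curve `f` into one for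
all of the nodes. -/
lemma IsFund.mul_left {n m : ℕ} {X : Finset Pt} {f g : Poly2} {A : Pt} (hA : eval A f ≠ 0)
    (hg : IsFund m (nonzerosIn X f) A g) (hn : f.totalDegree + m ≤ n) :
    IsFund n X A (f * (C (eval A f)⁻¹ * g)) := by
  refine ⟨?_, ?_, fun P hP hne => ?_⟩
  · refine (totalDegree_mul _ _).trans ((Nat.add_le_add_left ?_ _).trans hn)
    refine (totalDegree_mul _ _).trans ?_
    rw [totalDegree_C, Nat.zero_add]
    exact hg.1
  · rw [map_mul, map_mul, eval_C, hg.2.1, mul_one, mul_inv_cancel₀ hA]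
  · by_cases h : eval P f = 0
    · rw [map_mul, h, zero_mul]
    · rw [map_mul, map_mul, hg.2.2 P (mem_filter.2 ⟨hP, h⟩) hne, mul_zero, mul_zero]

/-- a squarefree curve `f` of degree `k`, `1 ≤ k ≤ n`, is a maximal curve for
the `n`-correct set `X` iff it is used by every node of `X` not lying on `f`. -/
theorem maximal_curve_iff_used (n k : ℕ) (X : Finset Pt) (hX : IsNCorrect n X)
    (f : Poly2) (hk1 : 1 ≤ k) (hkn : k ≤ n) (hdeg : f.totalDegree = k)
    (hsf : Squarefree f) :
    IsMaximalCurve n k X f ↔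
      ∀ A ∈ X, eval A f ≠ 0 → ∀ p : Poly2, IsFund n X A p → f ∣ p := by
  subst hdeg
  have hf : f ≠ 0 := hsf.ne_zero
  have hzero := hX.eq_zero_of_nonzerosIn hf hkn
  rw [hX.isMaximalCurve_iff hkn]
  constructor
  · intro hcard A hA hfA p hp
    obtain ⟨g, hg⟩ := IsNCorrect.exists_isFund ⟨hcard, hzero⟩ (mem_filter.2 ⟨hA, hfA⟩)
    rw [hX.isFund_unique hp (hg.mul_left hfA (by omega))]
    exact dvd_mul_right _ _
  · intro h
    refine le_antisymm (card_le_Nn fun A hA => ?_) (Nn_le_card hzero)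
    obtain ⟨hAX, hfA⟩ := mem_filter.1 hA
    obtain ⟨p, hp⟩ := hX.exists_isFund hAX
    obtain ⟨g, rfl⟩ := h A hAX hfA p hp
    have hA₁ : eval A f * eval A g = 1 := by rw [← map_mul, hp.2.1]
    have hgA : eval A g ≠ 0 := right_ne_zero_of_mul_eq_one hA₁
    have hg : g ≠ 0 := by
      rintro rfl
      exact hgA (map_zero _)
    refine ⟨g, ?_, hgA, fun P hP hne => ?_⟩
    · have := hp.1
      rw [totalDegree_mul_of_isDomain hf hg] at this
      omega
    · obtain ⟨hPX, hfP⟩ := mem_filter.1 hP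
      have := hp.2.2 P hPX hne
      rw [map_mul] at this
      exact (mul_eq_zero.1 this).resolve_left hfP
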